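/- Let H be a complex Hilbert space. Then the λ-function on the closed unit ball of C_1(H) is continuous with respect to the trace norm ‖·‖₁. -/

import Mathlib

/-! Setting: `H` is a complex Hilbert space, and we consider the space `C₁(H)` of trace class
operators on `H` (more generally the Schatten classes `C_p(H)`), regarded as those bounded
operators `a : H →L[ℂ] H` that are compact and whose sequence of singular values is
`p`-summable. The singular values `μₙ(a)` of a compact operator `a` (the eigenvalues of
`|a| = (a^* a)^(1/2)` arranged in decreasing order and repeated according to multiplicity)
are realized here via the approximation numbers, which coincide with them. -/

/-- `sValue a n` is the `n`-th approximation number (`0`-indexed) of `a`, namely the distance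
from `a` to the operators of rank at most `n`.  For a compact operator on a Hilbert space this
coincides with the `(n+1)`-th singular value `μ_{n+1}(a)`, i.e. the `(n+1)`-th eigenvalue of
`|a| = (a^* a)^(1/2)` arranged in decreasing order and repeated according to multiplicity.  In
particular `sValue a 0 = μ₁(a) = ‖a‖`. -/
noncomputable def sValue {H : Type*} [NormedAddCommGroup H] [InnerProductSpace ℂ H]
    (a : H →L[ℂ] H) (n : ℕ) : ℝ :=
  sInf {r : ℝ | ∃ F : H →L[ℂ] H, LinearMap.rank (F : H →ₗ[ℂ] H) ≤ (n : Cardinal) ∧ r = ‖a - F‖}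

/-- Membership in the Schatten class `C_p(H)`: `a` is a compact operator with
`‖a‖_p^p = ∑ₙ μₙ(a)^p < ∞`. -/
def MemSchatten {H : Type*} [NormedAddCommGroup H] [InnerProductSpace ℂ H]
    (p : ℝ) (a : H →L[ℂ] H) : Prop :=
  IsCompactOperator a ∧ Summable (fun n => sValue a n ^ p)

/-- Membership in the trace class `C₁(H)`: `a` is a compact operator with
`‖a‖₁ = tr |a| = ∑ₙ μₙ(a) < ∞`. -/
def MemTraceClass {H : Type*} [NormedAddCommGroup H] [InnerProductSpace ℂ H]
    (a : H →L[ℂ] H) : Prop :=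
  IsCompactOperator a ∧ Summable (fun n => sValue a n)

/-- The trace norm `‖a‖₁ = tr |a| = ∑ₙ μₙ(a)`. -/
noncomputable def traceNorm {H : Type*} [NormedAddCommGroup H] [InnerProductSpace ℂ H]
    (a : H →L[ℂ] H) : ℝ :=
  ∑' n, sValue a n

/-- The closed unit ball of `C₁(H)` with respect to the trace norm `‖·‖₁`. -/
def traceBall (H : Type*) [NormedAddCommGroup H] [InnerProductSpace ℂ H] :
    Set (H →L[ℂ] H) :=
  {x | MemTraceClass x ∧ traceNorm x ≤ 1}

/-- The λ-function of Aron and Lohman on the closed unit ball of `C₁(H)`: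
`λ(a) = sup { t : (e, y, t) ∈ ∂ₑ(B) × B × [0,1] is a triplet amenable to a }`,
where a triplet `(e, y, t)` is amenable to `a` when `a = t • e + (1 - t) • y`. -/
noncomputable def lambdaFn {H : Type*} [NormedAddCommGroup H] [InnerProductSpace ℂ H]
    (a : H →L[ℂ] H) : ℝ :=
  sSup {t : ℝ | t ∈ Set.Icc (0 : ℝ) 1 ∧
    ∃ e ∈ Set.extremePoints ℝ (traceBall H), ∃ y ∈ traceBall H, a = t • e + (1 - t) • y}

/-- A minimal (i.e. rank-one) partial isometry: `e e^* e = e` and `e` has rank one. -/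
def IsMinimalPartialIsometry {H : Type*} [NormedAddCommGroup H] [InnerProductSpace ℂ H]
    [CompleteSpace H] (e : H →L[ℂ] H) : Prop :=
  e ∘L (ContinuousLinearMap.adjoint e) ∘L e = e ∧ LinearMap.rank (e : H →ₗ[ℂ] H) = 1

/-- The rank one operator `η ⊗ ξ : ζ ↦ ⟨ζ, ξ⟩ η` (Mathlib's inner product being conjugate
linear in the first variable, this is `ζ ↦ ⟪ξ, ζ⟫ • η`). -/
noncomputable def rankOneOp {H : Type*} [NormedAddCommGroup H] [InnerProductSpace ℂ H]
    (η ξ : H) : H →L[ℂ] H :=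
  (innerSL ℂ ξ).smulRight η

open Filter Topology ComplexConjugate
open scoped InnerProductSpace

section Approximation

variable {H : Type*} [NormedAddCommGroup H] [InnerProductSpace ℂ H]

theorem sValue_le {a F : H →L[ℂ] H} {n : ℕ} (hF : LinearMap.rank (F : H →ₗ[ℂ] H) ≤ n) :
    sValue a n ≤ ‖a - F‖ :=
  csInf_le ⟨0, by rintro _ ⟨F, -, rfl⟩; exact norm_nonneg _⟩ ⟨F, hF, rfl⟩

theorem le_sValue {a : H →L[ℂ] H} {n : ℕ} {r : ℝ}
    (h : ∀ F : H →L[ℂ] H, LinearMap.rank (F : H →ₗ[ℂ] H) ≤ n → r ≤ ‖a - F‖) :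
    r ≤ sValue a n := by
  refine le_csInf ⟨‖a - 0‖, 0, ?_, rfl⟩ ?_
  · simp
  · rintro _ ⟨F, hF, rfl⟩
    exact h F hF

theorem sValue_nonneg (a : H →L[ℂ] H) (n : ℕ) : 0 ≤ sValue a n :=
  le_sValue fun _ _ => norm_nonneg _

theorem sValue_zero_index (a : H →L[ℂ] H) : sValue a 0 = ‖a‖ := by
  refine le_antisymm ?_ (le_sValue fun F hF => ?_)
  · simpa using sValue_le (a := a) (F := 0) (n := 0) (by simp)
  · have h0 : (F : H →ₗ[ℂ] H) = 0 := by
      rw [← LinearMap.range_eq_bot, ← Submodule.rank_eq_zero]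
      simpa [LinearMap.rank] using hF
    have : F = 0 := by ext v; exact LinearMap.congr_fun h0 v
    simp [this]

theorem rank_real_smul_le (c : ℝ) (F : H →L[ℂ] H) :
    LinearMap.rank ((c • F : H →L[ℂ] H) : H →ₗ[ℂ] H) ≤ LinearMap.rank (F : H →ₗ[ℂ] H) := by
  refine Submodule.rank_mono ?_
  rintro _ ⟨v, rfl⟩
  exact ⟨(c : ℂ) • v, by simp⟩

theorem rank_rankOneOp_le (f e : H) :
    LinearMap.rank (rankOneOp f e : H →ₗ[ℂ] H) ≤ 1 := by
  refine (Submodule.rank_mono (t := ℂ ∙ f) ?_).trans ((rank_span_le _).trans (by simp))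
  rintro _ ⟨v, rfl⟩
  exact Submodule.mem_span_singleton.2 ⟨⟪e, v⟫_ℂ, by simp [rankOneOp]⟩

theorem rankOneOp_apply (f e v : H) : rankOneOp f e v = ⟪e, v⟫_ℂ • f := by
  simp [rankOneOp]

theorem isCompactOperator_rankOneOp (f e : H) : IsCompactOperator (rankOneOp f e) := by
  have : IsCompactOperator (innerSL ℂ e : H →L[ℂ] ℂ) :=
    isCompactOperator_of_locallyCompactSpace_dom (innerSL ℂ e)
  exact this.clm_comp ((ContinuousLinearMap.id ℂ ℂ).smulRight f)

theorem sValue_real_smul_le (c : ℝ) (a : H →L[ℂ] H) (n : ℕ) :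
    sValue (c • a) n ≤ |c| * sValue a n := by
  rcases eq_or_ne c 0 with rfl | hc
  · simpa using sValue_le (a := (0 : H →L[ℂ] H)) (F := 0) (n := n) (by simp)
  have hc' : 0 < |c| := abs_pos.2 hc
  rw [mul_comm, ← div_le_iff₀ hc']
  refine le_sValue fun F hF => ?_
  rw [div_le_iff₀ hc']
  calc sValue (c • a) n ≤ ‖c • a - c • F‖ := sValue_le ((rank_real_smul_le c F).trans hF)
    _ = ‖a - F‖ * |c| := by rw [← smul_sub, norm_smul, Real.norm_eq_abs, mul_comm]

theorem sValue_succ_le_of_rank_le_one {e y : H →L[ℂ] H}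
    (he : LinearMap.rank (e : H →ₗ[ℂ] H) ≤ 1) (t c : ℝ) (n : ℕ) :
    sValue (t • e + c • y) (n + 1) ≤ |c| * sValue y n := by
  rcases eq_or_ne c 0 with rfl | hc
  · have := sValue_le (a := t • e) (F := t • e) (n := n + 1)
      ((rank_real_smul_le t e).trans (he.trans (by simp)))
    simpa using this
  have hc' : 0 < |c| := abs_pos.2 hc
  rw [mul_comm, ← div_le_iff₀ hc']
  refine le_sValue fun F hF => ?_
  rw [div_le_iff₀ hc']
  calc sValue (t • e + c • y) (n + 1) ≤ ‖t • e + c • y - (t • e + c • F)‖ := by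
        refine sValue_le ?_
        push_cast
        refine (LinearMap.rank_add_le _ _).trans ?_
        rw [add_comm]
        exact add_le_add ((rank_real_smul_le c F).trans hF) ((rank_real_smul_le t e).trans he)
    _ = ‖y - F‖ * |c| := by
        rw [add_sub_add_left_eq_sub, ← smul_sub, norm_smul, Real.norm_eq_abs, mul_comm]

theorem norm_sub_inner_smul_le {e : H} (he : e = 0 ∨ ‖e‖ = 1) (v : H) :
    ‖v - ⟪e, v⟫_ℂ • e‖ ≤ ‖v‖ := by
  rcases he with rfl | he
  · simp
  have h1 : ⟪⟪e, v⟫_ℂ • e, v - ⟪e, v⟫_ℂ • e⟫_ℂ = 0 := by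
    rw [inner_smul_left, inner_sub_right, inner_smul_right, inner_self_eq_norm_sq_to_K, he]
    simp
  have h2 := norm_add_sq_eq_norm_sq_add_norm_sq_of_inner_eq_zero _ _ h1
  rw [add_sub_cancel] at h2
  nlinarith [norm_nonneg v, norm_nonneg (v - ⟪e, v⟫_ℂ • e), mul_self_nonneg ‖⟪e, v⟫_ℂ • e‖]

/-- A family of pairwise orthogonal vectors each of which is zero or a unit vector. -/
structure IsPartialOrthonormal {ι : Type*} (u : ι → H) : Prop where
  pairwise : Pairwise fun i j => ⟪u i, u j⟫_ℂ = 0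
  cases : ∀ i, u i = 0 ∨ ‖u i‖ = 1

theorem IsPartialOrthonormal.sum_norm_inner_sq_le {ι : Type*} {u : ι → H}
    (hu : IsPartialOrthonormal u) (s : Finset ι) (x : H) :
    ∑ i ∈ s, ‖⟪u i, x⟫_ℂ‖ ^ 2 ≤ ‖x‖ ^ 2 := by
  classical
  have ho : Orthonormal ℂ fun i : {i // u i ≠ 0} => u i :=
    ⟨fun i => (hu.cases i).resolve_left i.2, fun i j hij =>
      hu.pairwise fun hij' => hij (Subtype.ext hij')⟩
  calc ∑ i ∈ s, ‖⟪u i, x⟫_ℂ‖ ^ 2 = ∑ i ∈ s with u i ≠ 0, ‖⟪u i, x⟫_ℂ‖ ^ 2 := by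
        refine (Finset.sum_filter_of_ne (p := fun i => u i ≠ 0) fun i _ hi h0 => hi ?_).symm
        simp [h0]
    _ = ∑ i ∈ s.subtype fun i => u i ≠ 0, ‖⟪u i, x⟫_ℂ‖ ^ 2 :=
        (Finset.sum_subtype_eq_sum_filter _).symm
    _ ≤ ‖x‖ ^ 2 := ho.sum_inner_products_le x

theorem IsPartialOrthonormal.sum_norm_inner_mul_inner_le {ι : Type*} {u v : ι → H}
    (hu : IsPartialOrthonormal u) (hv : IsPartialOrthonormal v) (s : Finset ι) {x y : H}
    (hx : ‖x‖ ≤ 1) (hy : ‖y‖ ≤ 1) :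
    ∑ i ∈ s, ‖⟪u i, x⟫_ℂ‖ * ‖⟪v i, y⟫_ℂ‖ ≤ 1 := by
  have h1 := (hu.sum_norm_inner_sq_le s x).trans (pow_le_one₀ (norm_nonneg _) hx)
  have h2 := (hv.sum_norm_inner_sq_le s y).trans (pow_le_one₀ (norm_nonneg _) hy)
  calc ∑ i ∈ s, ‖⟪u i, x⟫_ℂ‖ * ‖⟪v i, y⟫_ℂ‖
      ≤ ∑ i ∈ s, (‖⟪u i, x⟫_ℂ‖ ^ 2 + ‖⟪v i, y⟫_ℂ‖ ^ 2) / 2 :=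
        Finset.sum_le_sum fun i _ => by
          nlinarith [sq_nonneg (‖⟪u i, x⟫_ℂ‖ - ‖⟪v i, y⟫_ℂ‖)]
    _ ≤ 1 := by
        rw [← Finset.sum_div, Finset.sum_add_distrib]; linarith

theorem MemTraceClass.real_smul {a : H →L[ℂ] H} (ha : MemTraceClass a) (c : ℝ) :
    MemTraceClass (c • a) :=
  ⟨ha.1.smul c, Summable.of_nonneg_of_le (sValue_nonneg _) (sValue_real_smul_le c a)
    (ha.2.mul_left _)⟩

theorem traceNorm_real_smul_le {a : H →L[ℂ] H} (ha : MemTraceClass a) (c : ℝ) :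
    traceNorm (c • a) ≤ |c| * traceNorm a := by
  rw [traceNorm, traceNorm, ← tsum_mul_left]
  exact (ha.real_smul c).2.tsum_le_tsum (sValue_real_smul_le c a) (ha.2.mul_left _)

theorem norm_le_traceNorm {a : H →L[ℂ] H} (ha : MemTraceClass a) : ‖a‖ ≤ traceNorm a := by
  rw [← sValue_zero_index]
  exact ha.2.le_tsum 0 fun _ _ => sValue_nonneg _ _

theorem zero_mem_traceBall : (0 : H →L[ℂ] H) ∈ traceBall H := by
  have h (n : ℕ) : sValue (0 : H →L[ℂ] H) n = 0 :=
    le_antisymm (by simpa using sValue_real_smul_le 0 (0 : H →L[ℂ] H) n) (sValue_nonneg _ _)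
  exact ⟨⟨isCompactOperator_zero, by simp [h]⟩, by simp [traceNorm, h]⟩

theorem rankOneOp_mem_traceBall {f e : H} (hf : ‖f‖ = 1) (he : ‖e‖ = 1) :
    rankOneOp f e ∈ traceBall H := by
  have h (n : ℕ) (hn : n ∉ ({0} : Finset ℕ)) : sValue (rankOneOp f e) n = 0 := by
    refine le_antisymm ?_ (sValue_nonneg _ _)
    have hn1 : 1 ≤ n := by simp at hn; omega
    simpa using sValue_le (a := rankOneOp f e) (F := rankOneOp f e) (n := n)
      ((rank_rankOneOp_le f e).trans (by exact_mod_cast hn1))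
  refine ⟨⟨isCompactOperator_rankOneOp f e, summable_of_ne_finset_zero h⟩, ?_⟩
  rw [traceNorm, tsum_eq_sum h, Finset.sum_singleton, sValue_zero_index]
  refine ContinuousLinearMap.opNorm_le_bound _ zero_le_one fun v => ?_
  rw [rankOneOp_apply, norm_smul, hf, mul_one]
  exact (norm_inner_le_norm _ _).trans (by rw [he])

theorem lambdaFn_nonneg (a : H →L[ℂ] H) : 0 ≤ lambdaFn a :=
  Real.sSup_nonneg fun _ ht => ht.1.1

theorem le_lambdaFn {a e y : H →L[ℂ] H} {t : ℝ} (ht : t ∈ Set.Icc (0 : ℝ) 1)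
    (he : e ∈ Set.extremePoints ℝ (traceBall H)) (hy : y ∈ traceBall H)
    (h : a = t • e + (1 - t) • y) : t ≤ lambdaFn a :=
  le_csSup ⟨1, fun _ hs => hs.1.2⟩ ⟨ht, e, he, y, hy, h⟩

end Approximation

section Schmidt

variable {H : Type*} [NormedAddCommGroup H] [InnerProductSpace ℂ H] [CompleteSpace H]

/-- `e` and `f` are a right and a left singular vector of `a` for the singular value `‖a‖`; they
are unit vectors unless `a = 0`, in which case both vanish. -/
structure IsTopSingularPair (a : H →L[ℂ] H) (e f : H) : Prop where
  apply_right : a e = (‖a‖ : ℂ) • f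
  adjoint_left : ContinuousLinearMap.adjoint a f = (‖a‖ : ℂ) • e
  norm_right : a ≠ 0 → ‖e‖ = 1
  norm_left : a ≠ 0 → ‖f‖ = 1
  right_eq_zero : a = 0 → e = 0
  left_eq_zero : a = 0 → f = 0

theorem IsCompactOperator.exists_isTopSingularPair {a : H →L[ℂ] H} (ha : IsCompactOperator a) :
    ∃ e f : H, IsTopSingularPair a e f := by
  by_cases h0 : a = 0
  · exact ⟨0, 0, by simp [h0], by simp, fun h => absurd h0 h, fun h => absurd h0 h,
      fun _ => rfl, fun _ => rfl⟩
  have hpos : 0 < ‖a‖ := norm_pos_iff.2 h0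
  have : Nontrivial H := by
    by_contra hH
    rw [not_nontrivial_iff_subsingleton] at hH
    exact h0 (Subsingleton.elim _ _)
  set S : H →L[ℂ] H := ContinuousLinearMap.adjoint a ∘L a with hS
  have hScomp : IsCompactOperator S := ha.clm_comp (ContinuousLinearMap.adjoint a)
  have hSsa : IsSelfAdjoint S := IsSelfAdjoint.star_mul_self a
  have hSn : ‖S‖ = ‖a‖ ^ 2 := by
    rw [hS, sq]; exact ContinuousLinearMap.norm_adjoint_comp_self a
  obtain ⟨μ, hμ, hμn⟩ := spectrum.exists_nnnorm_eq_spectralRadius S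
  rw [S.spectralRadius_eq_nnnorm hSsa] at hμn
  have hμn' : ‖μ‖ = ‖a‖ ^ 2 := by
    rw [← hSn]; exact congrArg NNReal.toReal (ENNReal.coe_injective hμn)
  have hμ0 : μ ≠ 0 := by rw [← norm_ne_zero_iff, hμn']; positivity
  obtain ⟨v, hv⟩ := ((hScomp.hasEigenvalue_iff_mem_spectrum hμ0).2 hμ).exists_hasEigenvector
  have hSv : S v = μ • v := hv.apply_eq_smul
  have hv0 : ‖v‖ ≠ 0 := norm_ne_zero_iff.2 hv.2
  obtain ⟨e, he1, hSe⟩ : ∃ e : H, ‖e‖ = 1 ∧ S e = μ • e := by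
    refine ⟨((‖v‖⁻¹ : ℝ) : ℂ) • v, ?_, ?_⟩
    · rw [norm_smul, Complex.norm_real, norm_inv, norm_norm, inv_mul_cancel₀ hv0]
    · rw [map_smul, hSv, smul_comm]
  have hae : ((‖a e‖ ^ 2 : ℝ) : ℂ) = μ := by
    have h1 : ⟪e, S e⟫_ℂ = ⟪a e, a e⟫_ℂ := by
      rw [hS, ContinuousLinearMap.comp_apply, ContinuousLinearMap.adjoint_inner_right]
    rw [hSe, inner_smul_right, inner_self_eq_norm_sq_to_K, inner_self_eq_norm_sq_to_K, he1] at h1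
    simpa using h1.symm
  have haen : ‖a e‖ = ‖a‖ := by
    rw [← hae, Complex.norm_real, norm_pow, norm_norm] at hμn'
    exact (pow_left_inj₀ (norm_nonneg _) (norm_nonneg _) two_ne_zero).1 hμn'
  have hne : (‖a‖ : ℂ) ≠ 0 := by exact_mod_cast hpos.ne'
  refine ⟨e, (‖a‖ : ℂ)⁻¹ • a e, ?_, ?_, fun _ => he1, fun _ => ?_, fun h => absurd h h0,
    fun h => absurd h h0⟩
  · rw [smul_smul, mul_inv_cancel₀ hne, one_smul]
  · have : ContinuousLinearMap.adjoint a (a e) = μ • e := hSe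
    rw [map_smul, this, smul_smul, ← hae, haen]
    congr 1
    push_cast
    field_simp
  · rw [norm_smul, haen, norm_inv, Complex.norm_real, norm_norm, inv_mul_cancel₀ hpos.ne']

/-- The greedy singular value decomposition of the compact operator `A 0`: at every step the
leading singular component of the remainder `A n` is split off. -/
structure IsSchmidtExpansion (A : ℕ → H →L[ℂ] H) (e f : ℕ → H) : Prop where
  compact : ∀ n, IsCompactOperator (A n)
  pair : ∀ n, IsTopSingularPair (A n) (e n) (f n)
  step : ∀ n, A n = (‖A n‖ : ℂ) • rankOneOp (f n) (e n) + A (n + 1)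

theorem IsCompactOperator.exists_isSchmidtExpansion {a : H →L[ℂ] H} (ha : IsCompactOperator a) :
    ∃ (A : ℕ → H →L[ℂ] H) (e f : ℕ → H), A 0 = a ∧ IsSchmidtExpansion A e f := by
  choose e f hef using fun b : {b : H →L[ℂ] H // IsCompactOperator b} =>
    b.2.exists_isTopSingularPair
  let next : {b : H →L[ℂ] H // IsCompactOperator b} → {b : H →L[ℂ] H // IsCompactOperator b} :=
    fun b => ⟨b.1 - (‖b.1‖ : ℂ) • rankOneOp (f b) (e b),
      b.2.sub ((isCompactOperator_rankOneOp _ _).smul _)⟩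
  let B : ℕ → {b : H →L[ℂ] H // IsCompactOperator b} := fun n => next^[n] ⟨a, ha⟩
  refine ⟨fun n => (B n).1, fun n => e (B n), fun n => f (B n), rfl, fun n => (B n).2,
    fun n => hef _, fun n => ?_⟩
  have : B (n + 1) = next (B n) := Function.iterate_succ_apply' _ _ _
  simp [this, next]

namespace IsSchmidtExpansion

variable {A : ℕ → H →L[ℂ] H} {e f : ℕ → H}

theorem shift (h : IsSchmidtExpansion A e f) :
    IsSchmidtExpansion (fun n => A (n + 1)) (fun n => e (n + 1)) (fun n => f (n + 1)) :=
  ⟨fun _ => h.compact _, fun _ => h.pair _, fun _ => h.step _⟩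

theorem succ_apply (h : IsSchmidtExpansion A e f) (n : ℕ) (v : H) :
    A (n + 1) v = A n v - ((‖A n‖ : ℂ) * ⟪e n, v⟫_ℂ) • f n := by
  have := congrArg (fun T : H →L[ℂ] H => T v) (h.step n)
  simp only [add_apply, smul_apply, rankOneOp_apply] at this
  rw [this, smul_smul]; abel

theorem succ_apply' (h : IsSchmidtExpansion A e f) (n : ℕ) (v : H) :
    A (n + 1) v = A n (v - ⟪e n, v⟫_ℂ • e n) := by
  rw [h.succ_apply, map_sub, map_smul, (h.pair n).apply_right, smul_smul, mul_comm]

theorem norm_e_le (h : IsSchmidtExpansion A e f) (n : ℕ) : ‖e n‖ ≤ 1 := by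
  by_cases h0 : A n = 0
  · simp [(h.pair n).right_eq_zero h0]
  · exact ((h.pair n).norm_right h0).le

theorem norm_f_le (h : IsSchmidtExpansion A e f) (n : ℕ) : ‖f n‖ ≤ 1 := by
  by_cases h0 : A n = 0
  · simp [(h.pair n).left_eq_zero h0]
  · exact ((h.pair n).norm_left h0).le

theorem e_cases (h : IsSchmidtExpansion A e f) (n : ℕ) : e n = 0 ∨ ‖e n‖ = 1 := by
  by_cases h0 : A n = 0
  · exact Or.inl ((h.pair n).right_eq_zero h0)
  · exact Or.inr ((h.pair n).norm_right h0)

theorem f_cases (h : IsSchmidtExpansion A e f) (n : ℕ) : f n = 0 ∨ ‖f n‖ = 1 := by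
  by_cases h0 : A n = 0
  · exact Or.inl ((h.pair n).left_eq_zero h0)
  · exact Or.inr ((h.pair n).norm_left h0)

theorem antitone_norm (h : IsSchmidtExpansion A e f) : Antitone fun n => ‖A n‖ := by
  refine antitone_nat_of_succ_le fun n => ContinuousLinearMap.opNorm_le_bound _ (norm_nonneg _) ?_
  intro v
  rw [h.succ_apply']
  exact (ContinuousLinearMap.le_opNorm _ _).trans
    (mul_le_mul_of_nonneg_left (norm_sub_inner_smul_le (h.e_cases n) v) (norm_nonneg _))

theorem apply_e_and_adjoint_f (h : IsSchmidtExpansion A e f) (i k : ℕ) :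
    A (i + 1 + k) (e i) = 0 ∧ ContinuousLinearMap.adjoint (A (i + 1 + k)) (f i) = 0 := by
  have adj (n : ℕ) (w : H) : ContinuousLinearMap.adjoint (A (n + 1)) w =
      ContinuousLinearMap.adjoint (A n) w - ((‖A n‖ : ℂ) * ⟪f n, w⟫_ℂ) • e n := by
    refine ext_inner_right ℂ fun v => ?_
    rw [ContinuousLinearMap.adjoint_inner_left, h.succ_apply, inner_sub_right, inner_sub_left,
      ContinuousLinearMap.adjoint_inner_left, inner_smul_right, inner_smul_left, map_mul,
      inner_conj_symm, Complex.conj_ofReal]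
    ring
  induction k with
  | zero =>
    rcases eq_or_ne (A i) 0 with h0 | h0
    · simp [h.succ_apply, adj, h0]
    · rw [add_zero, h.succ_apply, adj, (h.pair i).apply_right, (h.pair i).adjoint_left,
        inner_self_eq_norm_sq_to_K, inner_self_eq_norm_sq_to_K, (h.pair i).norm_right h0,
        (h.pair i).norm_left h0]
      simp
  | succ k ih =>
    have h1 : (‖A (i + 1 + k)‖ : ℂ) * ⟪e (i + 1 + k), e i⟫_ℂ = 0 := by
      have := ContinuousLinearMap.adjoint_inner_left (A (i + 1 + k)) (e i) (f (i + 1 + k))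
      rw [ih.1, (h.pair _).adjoint_left, inner_smul_left, Complex.conj_ofReal] at this
      simpa using this
    have h2 : (‖A (i + 1 + k)‖ : ℂ) * ⟪f (i + 1 + k), f i⟫_ℂ = 0 := by
      have := ContinuousLinearMap.adjoint_inner_right (A (i + 1 + k)) (e (i + 1 + k)) (f i)
      rw [ih.2, (h.pair _).apply_right, inner_smul_left, Complex.conj_ofReal] at this
      simpa using this.symm
    rw [← add_assoc, h.succ_apply, adj, ih.1, ih.2, h1, h2]
    simp

theorem inner_eq_zero_of_lt (h : IsSchmidtExpansion A e f) {i j : ℕ} (hij : i < j) :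
    ⟪e j, e i⟫_ℂ = 0 ∧ ⟪f j, f i⟫_ℂ = 0 := by
  obtain ⟨k, rfl⟩ : ∃ k, j = i + 1 + k := ⟨j - (i + 1), by omega⟩
  rcases eq_or_ne (A (i + 1 + k)) 0 with h0 | h0
  · simp [(h.pair _).right_eq_zero h0, (h.pair _).left_eq_zero h0]
  have hne : (‖A (i + 1 + k)‖ : ℂ) ≠ 0 := by exact_mod_cast norm_ne_zero_iff.2 h0
  obtain ⟨hA, hA'⟩ := h.apply_e_and_adjoint_f i k
  constructor
  · have := ContinuousLinearMap.adjoint_inner_left (A (i + 1 + k)) (e i) (f (i + 1 + k))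
    rw [hA, (h.pair _).adjoint_left, inner_smul_left, Complex.conj_ofReal] at this
    simpa [hne, h0] using this
  · have := ContinuousLinearMap.adjoint_inner_right (A (i + 1 + k)) (e (i + 1 + k)) (f i)
    rw [hA', (h.pair _).apply_right, inner_smul_left, Complex.conj_ofReal] at this
    simpa [hne, h0] using this.symm

theorem pairwise_e (h : IsSchmidtExpansion A e f) : Pairwise fun i j => ⟪e i, e j⟫_ℂ = 0 := by
  intro i j hij
  rcases hij.lt_or_gt with hlt | hlt
  · exact inner_eq_zero_symm.1 (h.inner_eq_zero_of_lt hlt).1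
  · exact (h.inner_eq_zero_of_lt hlt).1

theorem pairwise_f (h : IsSchmidtExpansion A e f) : Pairwise fun i j => ⟪f i, f j⟫_ℂ = 0 := by
  intro i j hij
  rcases hij.lt_or_gt with hlt | hlt
  · exact inner_eq_zero_symm.1 (h.inner_eq_zero_of_lt hlt).2
  · exact (h.inner_eq_zero_of_lt hlt).2

theorem eq_sum_add (h : IsSchmidtExpansion A e f) (n : ℕ) :
    A 0 = ∑ i ∈ Finset.range n, (‖A i‖ : ℂ) • rankOneOp (f i) (e i) + A n := by
  induction n with
  | zero => simp
  | succ n ih => rw [Finset.sum_range_succ, add_assoc, ← h.step n]; exact ih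

theorem zero_apply_e (h : IsSchmidtExpansion A e f) (i : ℕ) :
    A 0 (e i) = (‖A i‖ : ℂ) • f i := by
  have h1 := congrArg (fun T : H →L[ℂ] H => T (e i)) (h.eq_sum_add i)
  simp only [add_apply, sum_apply,
    smul_apply, rankOneOp_apply] at h1
  rw [h1, (h.pair i).apply_right, Finset.sum_eq_zero, zero_add]
  intro j hj
  rw [h.pairwise_e (Finset.mem_range.1 hj).ne]
  simp

theorem norm_le_sValue (h : IsSchmidtExpansion A e f) (n : ℕ) : ‖A n‖ ≤ sValue (A 0) n := by
  rcases eq_or_ne (A n) 0 with h0 | h0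
  · rw [h0, norm_zero]; exact sValue_nonneg _ _
  have hpos : 0 < ‖A n‖ := norm_pos_iff.2 h0
  have hA (i : Fin (n + 1)) : ‖A n‖ ≤ ‖A i‖ := h.antitone_norm (Nat.lt_succ_iff.1 i.2)
  have hA0 (i : Fin (n + 1)) : A i ≠ 0 := norm_pos_iff.1 (hpos.trans_le (hA i))
  have he : Orthonormal ℂ fun i : Fin (n + 1) => e i :=
    ⟨fun i => (h.pair _).norm_right (hA0 i), fun i j hij =>
      h.pairwise_e fun hij' => hij (Fin.ext hij')⟩
  have hf : Orthonormal ℂ fun i : Fin (n + 1) => f i :=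
    ⟨fun i => (h.pair _).norm_left (hA0 i), fun i j hij =>
      h.pairwise_f fun hij' => hij (Fin.ext hij')⟩
  refine le_sValue fun F hF => ?_
  have hfin : Module.Finite ℂ (LinearMap.range (F : H →ₗ[ℂ] H)) :=
    Module.rank_lt_aleph0_iff.1 (lt_of_le_of_lt hF Cardinal.natCast_lt_aleph0)
  have hrank : Module.finrank ℂ (LinearMap.range (F : H →ₗ[ℂ] H)) ≤ n :=
    Module.finrank_le_of_rank_le hF
  let L : (Fin (n + 1) → ℂ) →ₗ[ℂ] LinearMap.range (F : H →ₗ[ℂ] H) :=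
    (F : H →ₗ[ℂ] H).rangeRestrict ∘ₗ Fintype.linearCombination ℂ fun i : Fin (n + 1) => e i
  have hker : LinearMap.ker L ≠ ⊥ :=
    LinearMap.ker_ne_bot_of_finrank_lt (by simpa using Nat.lt_succ_of_le hrank)
  obtain ⟨c, hc, hc0⟩ := Submodule.exists_mem_ne_zero_of_ne_bot hker
  set v : H := ∑ i, c i • e (i : ℕ) with hv
  have hFv : F v = 0 := by
    have := congrArg Subtype.val (LinearMap.mem_ker.1 hc)
    simpa [L, Fintype.linearCombination_apply, hv] using this
  have hv2 : ‖v‖ ^ 2 = ∑ i, ‖c i‖ ^ 2 := by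
    have := he.inner_sum c c Finset.univ
    rw [← hv, inner_self_eq_norm_sq_to_K] at this
    have h2 : ((‖v‖ ^ 2 : ℝ) : ℂ) = ((∑ i, ‖c i‖ ^ 2 : ℝ) : ℂ) := by
      push_cast
      simpa [Complex.conj_mul'] using this
    exact_mod_cast h2
  have hav : A 0 v = ∑ i : Fin (n + 1), (c i * (‖A i‖ : ℂ)) • f i := by
    rw [hv, map_sum]
    refine Finset.sum_congr rfl fun i _ => ?_
    rw [map_smul, h.zero_apply_e, smul_smul]
  have hav2 : ‖A 0 v‖ ^ 2 = ∑ i : Fin (n + 1), (‖c i‖ * ‖A i‖) ^ 2 := by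
    have := hf.inner_sum (fun i => c i * (‖A i‖ : ℂ)) (fun i => c i * (‖A i‖ : ℂ)) Finset.univ
    rw [← hav, inner_self_eq_norm_sq_to_K] at this
    have h2 : ((‖A 0 v‖ ^ 2 : ℝ) : ℂ) =
        ((∑ i : Fin (n + 1), (‖c i‖ * ‖A i‖) ^ 2 : ℝ) : ℂ) := by
      push_cast
      simpa only [Complex.conj_mul', norm_mul, Complex.norm_real, norm_norm, Complex.ofReal_mul,
        Complex.coe_algebraMap] using this
    exact_mod_cast h2
  have hvpos : 0 < ‖v‖ := by
    obtain ⟨i, hi⟩ := Function.ne_iff.1 hc0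
    have : 0 < ‖v‖ ^ 2 := by
      rw [hv2]
      exact Finset.sum_pos' (fun _ _ => sq_nonneg _)
        ⟨i, Finset.mem_univ _, pow_pos (norm_pos_iff.2 hi) 2⟩
    exact (norm_nonneg v).lt_of_ne fun h0 => by rw [← h0] at this; simp at this
  have hlow : ‖A n‖ * ‖v‖ ≤ ‖A 0 v‖ := by
    refine le_of_sq_le_sq ?_ (norm_nonneg _)
    rw [mul_pow, hv2, hav2, Finset.mul_sum]
    refine Finset.sum_le_sum fun i _ => ?_
    rw [mul_pow, mul_comm]
    exact mul_le_mul_of_nonneg_left (pow_le_pow_left₀ (norm_nonneg _) (hA i) 2) (sq_nonneg _)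
  refine le_of_mul_le_mul_right (hlow.trans ?_) hvpos
  calc ‖A 0 v‖ = ‖(A 0 - F) v‖ := by rw [sub_apply, hFv, sub_zero]
    _ ≤ ‖A 0 - F‖ * ‖v‖ := ContinuousLinearMap.le_opNorm _ _

theorem sValue_eq (h : IsSchmidtExpansion A e f) (n : ℕ) : sValue (A 0) n = ‖A n‖ := by
  refine le_antisymm ?_ (h.norm_le_sValue n)
  have hsum := h.eq_sum_add n
  have : A n = A 0 - ∑ i ∈ Finset.range n, (‖A i‖ : ℂ) • rankOneOp (f i) (e i) :=
    eq_sub_of_add_eq' hsum.symm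
  conv_rhs => rw [this]
  refine sValue_le ?_
  rw [ContinuousLinearMap.toLinearMap_sum]
  refine (LinearMap.rank_finsetSum_le _ _).trans ?_
  refine (Finset.sum_le_card_nsmul _ _ 1 fun i _ => ?_).trans (by simp)
  have hreal : (‖A i‖ : ℂ) • rankOneOp (f i) (e i) = ‖A i‖ • rankOneOp (f i) (e i) := by
    ext; simp
  rw [hreal]
  exact (rank_real_smul_le _ _).trans (rank_rankOneOp_le _ _)

theorem isPartialOrthonormal_e (h : IsSchmidtExpansion A e f) : IsPartialOrthonormal e :=
  ⟨h.pairwise_e, h.e_cases⟩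

theorem isPartialOrthonormal_f (h : IsSchmidtExpansion A e f) : IsPartialOrthonormal f :=
  ⟨h.pairwise_f, h.f_cases⟩

theorem sum_re_inner_le_sum_add (h : IsSchmidtExpansion A e f) {ι : Type*} {u v : ι → H}
    (hu : IsPartialOrthonormal u) (hv : IsPartialOrthonormal v) (s : Finset ι) (n : ℕ) :
    ∑ i ∈ s, (⟪v i, A 0 (u i)⟫_ℂ).re ≤ ∑ j ∈ Finset.range n, ‖A j‖ + s.card * ‖A n‖ := by
  have hle {u : ι → H} (hu : IsPartialOrthonormal u) (i : ι) : ‖u i‖ ≤ 1 := by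
    rcases hu.cases i with hi | hi <;> simp [hi]
  have hterm (i : ι) : (⟪v i, A 0 (u i)⟫_ℂ).re ≤
      ∑ j ∈ Finset.range n, ‖A j‖ * (‖⟪u i, e j⟫_ℂ‖ * ‖⟪v i, f j⟫_ℂ‖) + ‖A n‖ := by
    have h1 : ⟪v i, A 0 (u i)⟫_ℂ = ∑ j ∈ Finset.range n,
        (‖A j‖ : ℂ) * (⟪e j, u i⟫_ℂ * ⟪v i, f j⟫_ℂ) + ⟪v i, A n (u i)⟫_ℂ := by
      have := congrArg (fun T : H →L[ℂ] H => ⟪v i, T (u i)⟫_ℂ) (h.eq_sum_add n)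
      simpa only [add_apply, sum_apply, smul_apply, rankOneOp_apply, inner_add_right, inner_sum,
        inner_smul_right] using this
    refine (Complex.re_le_norm _).trans ?_
    rw [h1]
    refine (norm_add_le _ _).trans (add_le_add ((norm_sum_le _ _).trans ?_) ?_)
    · refine Finset.sum_le_sum fun j _ => ?_
      rw [norm_mul, norm_mul, Complex.norm_real, norm_norm, norm_inner_symm (e j)]
    · calc ‖⟪v i, A n (u i)⟫_ℂ‖ ≤ ‖v i‖ * ‖A n (u i)‖ := norm_inner_le_norm _ _
        _ ≤ 1 * (‖A n‖ * 1) := by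
          refine mul_le_mul (hle hv i) ?_ (norm_nonneg _) zero_le_one
          exact (ContinuousLinearMap.le_opNorm _ _).trans
            (mul_le_mul_of_nonneg_left (hle hu i) (norm_nonneg _))
        _ = ‖A n‖ := by ring
  refine (Finset.sum_le_sum fun i _ => hterm i).trans ?_
  rw [Finset.sum_add_distrib, Finset.sum_const, nsmul_eq_mul, Finset.sum_comm]
  refine add_le_add (Finset.sum_le_sum fun j _ => ?_) le_rfl
  rw [← Finset.mul_sum]
  exact mul_le_of_le_one_right (norm_nonneg _)
    (hu.sum_norm_inner_mul_inner_le hv s (h.norm_e_le j) (h.norm_f_le j))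

end IsSchmidtExpansion

theorem MemTraceClass.sum_re_inner_le {a : H →L[ℂ] H} (ha : MemTraceClass a) {ι : Type*}
    {u v : ι → H} (hu : IsPartialOrthonormal u) (hv : IsPartialOrthonormal v) (s : Finset ι) :
    ∑ i ∈ s, (⟪v i, a (u i)⟫_ℂ).re ≤ traceNorm a := by
  obtain ⟨A, e, f, rfl, h⟩ := ha.1.exists_isSchmidtExpansion
  have hs : Summable fun n => ‖A n‖ := by simpa only [h.sValue_eq] using ha.2
  have ht : traceNorm (A 0) = ∑' n, ‖A n‖ := tsum_congr h.sValue_eq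
  rw [ht]
  have hlim : Tendsto (fun n => ∑' j, ‖A j‖ + s.card * ‖A n‖) atTop
      (𝓝 (∑' j, ‖A j‖ + s.card * 0)) :=
    tendsto_const_nhds.add (hs.tendsto_atTop_zero.const_mul _)
  rw [mul_zero, add_zero] at hlim
  refine ge_of_tendsto' hlim fun n => (h.sum_re_inner_le_sum_add hu hv s n).trans ?_
  exact add_le_add (hs.sum_le_tsum _ fun _ _ => norm_nonneg _) le_rfl

theorem IsCompactOperator.exists_sum_sValue_eq {a : H →L[ℂ] H} (ha : IsCompactOperator a) :
    ∃ u v : ℕ → H, IsPartialOrthonormal u ∧ IsPartialOrthonormal v ∧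
      ∀ n, sValue a n = (⟪v n, a (u n)⟫_ℂ).re := by
  obtain ⟨A, e, f, rfl, h⟩ := ha.exists_isSchmidtExpansion
  refine ⟨e, f, h.isPartialOrthonormal_e, h.isPartialOrthonormal_f, fun n => ?_⟩
  rw [h.sValue_eq, h.zero_apply_e, inner_smul_right, inner_self_eq_norm_sq_to_K]
  rcases eq_or_ne (A n) 0 with h0 | h0
  · simp [h0]
  · simp [(h.pair n).norm_left h0]

theorem MemTraceClass.add_and_traceNorm_add_le {a b : H →L[ℂ] H} (ha : MemTraceClass a)
    (hb : MemTraceClass b) :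
    MemTraceClass (a + b) ∧ traceNorm (a + b) ≤ traceNorm a + traceNorm b := by
  have hc : IsCompactOperator (a + b : H →L[ℂ] H) := ha.1.add hb.1
  obtain ⟨u, v, hu, hv, huv⟩ := hc.exists_sum_sValue_eq
  have hle (n : ℕ) :
      ∑ i ∈ Finset.range n, sValue (a + b) i ≤ traceNorm a + traceNorm b := by
    simp only [huv, add_apply, inner_add_right, Complex.add_re, Finset.sum_add_distrib]
    exact add_le_add (ha.sum_re_inner_le hu hv _) (hb.sum_re_inner_le hu hv _)
  exact ⟨⟨hc, summable_of_sum_range_le (sValue_nonneg _) hle⟩,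
    Real.tsum_le_of_sum_range_le (sValue_nonneg _) hle⟩

theorem MemTraceClass.add {a b : H →L[ℂ] H} (ha : MemTraceClass a) (hb : MemTraceClass b) :
    MemTraceClass (a + b) :=
  (ha.add_and_traceNorm_add_le hb).1

theorem traceNorm_add_le {a b : H →L[ℂ] H} (ha : MemTraceClass a) (hb : MemTraceClass b) :
    traceNorm (a + b) ≤ traceNorm a + traceNorm b :=
  (ha.add_and_traceNorm_add_le hb).2

theorem MemTraceClass.sub {a b : H →L[ℂ] H} (ha : MemTraceClass a) (hb : MemTraceClass b) :
    MemTraceClass (a - b) := by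
  simpa [sub_eq_add_neg] using ha.add (hb.real_smul (-1))

theorem traceNorm_sub_comm {a b : H →L[ℂ] H} (ha : MemTraceClass a) (hb : MemTraceClass b) :
    traceNorm (a - b) = traceNorm (b - a) := by
  refine le_antisymm ?_ ?_
  · simpa using traceNorm_real_smul_le (hb.sub ha) (-1)
  · simpa using traceNorm_real_smul_le (ha.sub hb) (-1)

theorem traceNorm_le_add_sub {a b : H →L[ℂ] H} (ha : MemTraceClass a) (hb : MemTraceClass b) :
    traceNorm b ≤ traceNorm a + traceNorm (b - a) := by
  simpa using traceNorm_add_le ha (hb.sub ha)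

theorem convex_traceBall : Convex ℝ (traceBall H) := by
  intro x hx y hy s t hs ht hst
  refine ⟨(hx.1.real_smul s).add (hy.1.real_smul t), ?_⟩
  have h1 := traceNorm_add_le (hx.1.real_smul s) (hy.1.real_smul t)
  have h2 := traceNorm_real_smul_le hx.1 s
  have h3 := traceNorm_real_smul_le hy.1 t
  rw [abs_of_nonneg hs] at h2
  rw [abs_of_nonneg ht] at h3
  nlinarith [mul_le_mul_of_nonneg_left hx.2 hs, mul_le_mul_of_nonneg_left hy.2 ht]

/-- The leading singular component of a trace class operator splits off additively for the
trace norm. -/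
theorem MemTraceClass.exists_eq_smul_rankOneOp_add {a : H →L[ℂ] H} (ha : MemTraceClass a)
    (h0 : a ≠ 0) : ∃ (e f : H) (b : H →L[ℂ] H), ‖e‖ = 1 ∧ ‖f‖ = 1 ∧ MemTraceClass b ∧
      a = ‖a‖ • rankOneOp f e + b ∧ traceNorm a = ‖a‖ + traceNorm b := by
  obtain ⟨A, e, f, rfl, h⟩ := ha.1.exists_isSchmidtExpansion
  have hs (n : ℕ) : sValue (A 1) n = sValue (A 0) (n + 1) := by
    rw [h.sValue_eq]; exact h.shift.sValue_eq n
  refine ⟨e 0, f 0, A 1, (h.pair 0).norm_right h0, (h.pair 0).norm_left h0, ⟨h.compact 1, ?_⟩,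
    ?_, ?_⟩
  · simpa only [hs] using (summable_nat_add_iff 1).2 ha.2
  · have hreal : (‖A 0‖ : ℂ) • rankOneOp (f 0) (e 0) = ‖A 0‖ • rankOneOp (f 0) (e 0) := by
      ext; simp
    rw [← hreal]
    exact h.step 0
  · simp only [traceNorm, hs]
    rw [ha.2.tsum_eq_zero_add, sValue_zero_index]

theorem rank_le_one_of_mem_extremePoints {e : H →L[ℂ] H}
    (he : e ∈ Set.extremePoints ℝ (traceBall H)) : LinearMap.rank (e : H →ₗ[ℂ] H) ≤ 1 := by
  rcases eq_or_ne e 0 with rfl | h0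
  · simp
  obtain ⟨⟨heT, he1⟩, hext⟩ := mem_extremePoints.1 he
  obtain ⟨ξ, η, b, hξ, hη, hb, hsplit, hT⟩ := heT.exists_eq_smul_rankOneOp_add h0
  rcases eq_or_ne b 0 with rfl | hb0
  · rw [hsplit, add_zero]
    exact (rank_real_smul_le _ _).trans (rank_rankOneOp_le _ _)
  have hbpos : 0 < traceNorm b := (norm_pos_iff.2 hb0).trans_le (norm_le_traceNorm hb)
  have hpos : 0 < ‖e‖ := norm_pos_iff.2 h0
  have hlt : 0 < 1 - ‖e‖ := by linarith
  have hball : (1 - ‖e‖)⁻¹ • b ∈ traceBall H := by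
    refine ⟨hb.real_smul _, (traceNorm_real_smul_le hb _).trans ?_⟩
    rw [abs_of_pos (inv_pos.2 hlt), inv_mul_le_iff₀ hlt]
    linarith
  have := (hext _ (rankOneOp_mem_traceBall hη hξ) _ hball
    ⟨‖e‖, 1 - ‖e‖, hpos, hlt, by ring, by
      rw [smul_inv_smul₀ hlt.ne']; exact hsplit.symm⟩).1
  rw [← this]
  exact rank_rankOneOp_le _ _

theorem eq_rankOneOp_of_one_le_re_inner {u : H →L[ℂ] H} (hu : u ∈ traceBall H) {η ξ : H}
    (hη : ‖η‖ = 1) (hξ : ‖ξ‖ = 1) (h : 1 ≤ (⟪η, u ξ⟫_ℂ).re) : u = rankOneOp η ξ := by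
  have hn : ‖u‖ ≤ 1 := (norm_le_traceNorm hu.1).trans hu.2
  have key {x y : H} (hx : ‖x‖ = 1) (hy : ‖y‖ ≤ 1) (hxy : 1 ≤ (⟪x, y⟫_ℂ).re) : y = x := by
    have h1 := norm_sub_sq (𝕜 := ℂ) y x
    have h2 : RCLike.re ⟪y, x⟫_ℂ = (⟪x, y⟫_ℂ).re := inner_re_symm y x
    rw [h2, hx] at h1
    have h3 : ‖y - x‖ ^ 2 ≤ 0 := by nlinarith [norm_nonneg y]
    exact sub_eq_zero.1 (norm_eq_zero.1 (pow_eq_zero_iff two_ne_zero |>.1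
      (le_antisymm h3 (sq_nonneg _))))
  have huξ : u ξ = η := key hη (u.le_of_opNorm_le_of_le hn hξ.le |>.trans (by simp)) h
  have huη : ContinuousLinearMap.adjoint u η = ξ := by
    refine key hξ ?_ ?_
    · have : ‖ContinuousLinearMap.adjoint u‖ ≤ 1 := by rwa [LinearIsometryEquiv.norm_map]
      exact (ContinuousLinearMap.le_of_opNorm_le_of_le _ this hη.le).trans (by simp)
    · rw [ContinuousLinearMap.adjoint_inner_right, huξ, inner_self_eq_norm_sq_to_K, hη]
      simp
  have hperp {w : H} (hw : ⟪ξ, w⟫_ℂ = 0) : u w = 0 := by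
    by_contra hne
    have hw0 : w ≠ 0 := by rintro rfl; simp at hne
    have hηw : ⟪η, u w⟫_ℂ = 0 := by rw [← ContinuousLinearMap.adjoint_inner_left, huη, hw]
    let p : Bool → H := fun i => cond i ξ (((‖w‖⁻¹ : ℝ) : ℂ) • w)
    let q : Bool → H := fun i => cond i η (((‖u w‖⁻¹ : ℝ) : ℂ) • u w)
    have hnorm {z : H} (hz : z ≠ 0) : ‖((‖z‖⁻¹ : ℝ) : ℂ) • z‖ = 1 := by
      rw [norm_smul, Complex.norm_real, norm_inv, norm_norm,
        inv_mul_cancel₀ (norm_ne_zero_iff.2 hz)]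
    have hp : IsPartialOrthonormal p := by
      refine ⟨?_, ?_⟩
      · rintro (_ | _) (_ | _) hij <;>
          simp [p, hw, inner_eq_zero_symm.1 hw] at hij ⊢
      · rintro (_ | _)
        · exact Or.inr (hnorm hw0)
        · exact Or.inr hξ
    have hq : IsPartialOrthonormal q := by
      refine ⟨?_, ?_⟩
      · rintro (_ | _) (_ | _) hij <;>
          simp [q, hηw, inner_eq_zero_symm.1 hηw] at hij ⊢
      · rintro (_ | _)
        · exact Or.inr (hnorm hne)
        · exact Or.inr hη
    have hsum := (hu.1.sum_re_inner_le hp hq Finset.univ).trans hu.2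
    rw [Fintype.sum_bool] at hsum
    have hpos : 0 < (⟪q false, u (p false)⟫_ℂ).re := by
      have : ⟪q false, u (p false)⟫_ℂ = ((‖u w‖⁻¹ * (‖w‖⁻¹ * ‖u w‖ ^ 2) : ℝ) : ℂ) := by
        simp only [p, q, cond_false, map_smul, inner_smul_left, inner_smul_right,
          inner_self_eq_norm_sq_to_K, Complex.conj_ofReal]
        push_cast
        exact mul_left_comm _ _ _
      rw [this, Complex.ofReal_re]
      have h1 := norm_pos_iff.2 hne
      have h2 := norm_pos_iff.2 hw0
      positivity
    have : (⟪q true, u (p true)⟫_ℂ).re = (⟪η, u ξ⟫_ℂ).re := rfl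
    linarith
  ext v
  have hv : ⟪ξ, v - ⟪ξ, v⟫_ℂ • ξ⟫_ℂ = 0 := by
    rw [inner_sub_right, inner_smul_right, inner_self_eq_norm_sq_to_K, hξ]; simp
  have := hperp hv
  rw [map_sub, map_smul, huξ, sub_eq_zero] at this
  rw [this, rankOneOp_apply]

theorem rankOneOp_mem_extremePoints {η ξ : H} (hη : ‖η‖ = 1) (hξ : ‖ξ‖ = 1) :
    rankOneOp η ξ ∈ Set.extremePoints ℝ (traceBall H) := by
  refine mem_extremePoints.2 ⟨rankOneOp_mem_traceBall hη hξ, ?_⟩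
  rintro x hx y hy ⟨s, t, hs, ht, hst, hxy⟩
  have hle {u : H →L[ℂ] H} (hu : u ∈ traceBall H) : (⟪η, u ξ⟫_ℂ).re ≤ 1 := by
    have hn : ‖u‖ ≤ 1 := (norm_le_traceNorm hu.1).trans hu.2
    calc (⟪η, u ξ⟫_ℂ).re ≤ ‖⟪η, u ξ⟫_ℂ‖ := Complex.re_le_norm _
      _ ≤ ‖η‖ * ‖u ξ‖ := norm_inner_le_norm _ _
      _ ≤ 1 := by
        rw [hη, one_mul]
        exact (u.le_of_opNorm_le_of_le hn hξ.le).trans (by simp)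
  have hval : s * (⟪η, x ξ⟫_ℂ).re + t * (⟪η, y ξ⟫_ℂ).re = 1 := by
    have h1 := congrArg (fun T : H →L[ℂ] H => (⟪η, T ξ⟫_ℂ).re) hxy
    simp only [add_apply, smul_apply, rankOneOp_apply, inner_add_right, inner_smul_right,
      inner_self_eq_norm_sq_to_K, hη, hξ, inner_smul_right_eq_smul] at h1
    simpa using h1
  have hx1 := hle hx
  have hy1 := hle hy
  exact ⟨eq_rankOneOp_of_one_le_re_inner hx hη hξ (by nlinarith),
    eq_rankOneOp_of_one_le_re_inner hy hη hξ (by nlinarith)⟩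

theorem norm_le_lambdaFn {a : H →L[ℂ] H} (ha : a ∈ traceBall H) : ‖a‖ ≤ lambdaFn a := by
  rcases eq_or_ne a 0 with rfl | h0
  · simpa using lambdaFn_nonneg (0 : H →L[ℂ] H)
  obtain ⟨ξ, η, b, hξ, hη, hb, hsplit, hT⟩ := ha.1.exists_eq_smul_rankOneOp_add h0
  have hle : ‖a‖ ≤ 1 := (norm_le_traceNorm ha.1).trans ha.2
  have hbT : traceNorm b ≤ 1 - ‖a‖ := by linarith [ha.2]
  rcases hle.eq_or_lt with h1 | h1
  · have hb0 : b = 0 := by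
      rw [h1, sub_self] at hbT
      exact norm_le_zero_iff.1 ((norm_le_traceNorm hb).trans hbT)
    refine le_lambdaFn ⟨norm_nonneg _, hle⟩ (rankOneOp_mem_extremePoints hη hξ)
      zero_mem_traceBall ?_
    rw [smul_zero, ← hb0]
    exact hsplit
  · have hlt : 0 < 1 - ‖a‖ := by linarith
    refine le_lambdaFn (y := (1 - ‖a‖)⁻¹ • b) ⟨norm_nonneg _, hle⟩
      (rankOneOp_mem_extremePoints hη hξ)
      ⟨hb.real_smul _, (traceNorm_real_smul_le hb _).trans ?_⟩ ?_
    · rwa [abs_of_pos (inv_pos.2 hlt), inv_mul_le_iff₀ hlt, mul_one]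
    · rw [smul_inv_smul₀ hlt.ne']
      exact hsplit

theorem lambdaFn_le {a : H →L[ℂ] H} (ha : a ∈ traceBall H) :
    lambdaFn a ≤ 1 - traceNorm a + ‖a‖ := by
  refine Real.sSup_le ?_ (by linarith [ha.2, norm_nonneg a])
  rintro t ⟨⟨-, ht1⟩, e, he, y, hy, hay⟩
  have hsucc (n : ℕ) : sValue a (n + 1) ≤ (1 - t) * sValue y n := by
    have := sValue_succ_le_of_rank_le_one (y := y) (rank_le_one_of_mem_extremePoints he) t (1 - t) n
    rwa [← hay, abs_of_nonneg (by linarith)] at this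
  have htail : ∑' n, sValue a (n + 1) ≤ (1 - t) * traceNorm y := by
    rw [traceNorm, ← tsum_mul_left]
    exact ((summable_nat_add_iff 1).2 ha.1.2).tsum_le_tsum hsucc (hy.1.2.mul_left _)
  have hsum : traceNorm a = ‖a‖ + ∑' n, sValue a (n + 1) := by
    rw [traceNorm, ha.1.2.tsum_eq_zero_add, sValue_zero_index]
  nlinarith [hy.2]

theorem lambdaFn_le_add {x z : H →L[ℂ] H} {θ : ℝ} (hx : x ∈ traceBall H) (hz : MemTraceClass z)
    (hθ : 0 < θ) (hθ1 : θ ≤ 1) (h : traceNorm x + θ⁻¹ * traceNorm (z - x) ≤ 1) :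
    lambdaFn x ≤ lambdaFn z + θ := by
  refine Real.sSup_le ?_ (add_nonneg (lambdaFn_nonneg _) hθ.le)
  rintro t ⟨⟨ht0, ht1⟩, e, he, y, hy, hxy⟩
  have hd : MemTraceClass (z - x) := hz.sub hx.1
  have hu : x + θ⁻¹ • (z - x) ∈ traceBall H := by
    refine ⟨hx.1.add (hd.real_smul _), (traceNorm_add_le hx.1 (hd.real_smul _)).trans ?_⟩
    have := traceNorm_real_smul_le hd θ⁻¹
    rw [abs_of_pos (inv_pos.2 hθ)] at this
    linarith
  have hc : 0 < 1 - (1 - θ) * t := by nlinarith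
  have hw : ((1 - θ) * (1 - t) / (1 - (1 - θ) * t)) • y +
      (θ / (1 - (1 - θ) * t)) • (x + θ⁻¹ • (z - x)) ∈ traceBall H := by
    refine convex_traceBall hy hu ?_ (by positivity) ?_
    · exact div_nonneg (mul_nonneg (by linarith) (by linarith)) hc.le
    · field_simp
      ring
  have hle : (1 - θ) * t ≤ lambdaFn z := by
    refine le_lambdaFn ⟨mul_nonneg (by linarith) ht0, by linarith⟩ he hw ?_
    rw [smul_add, smul_smul, smul_smul, mul_div_cancel₀ _ hc.ne', mul_div_cancel₀ _ hc.ne',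
      smul_add, smul_smul, mul_inv_cancel₀ hθ.ne', one_smul]
    have : (1 - θ) • x = ((1 - θ) * t) • e + ((1 - θ) * (1 - t)) • y := by
      conv_lhs => rw [hxy]
      rw [smul_add, smul_smul, smul_smul]
    rw [← add_assoc, ← this, sub_smul, one_smul]
    abel
  nlinarith

end Schmidt

/-- Let `H` be a complex Hilbert space. The λ-function on the closed unit
ball of `C₁(H)` is continuous with respect to the trace norm `‖·‖₁`. -/
theorem lambdaFn_continuous_traceNorm {H : Type*} [NormedAddCommGroup H]
    [InnerProductSpace ℂ H] [CompleteSpace H] (a : H →L[ℂ] H) (ha : a ∈ traceBall H)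
    (ε : ℝ) (hε : 0 < ε) :
    ∃ δ > 0, ∀ b ∈ traceBall H, traceNorm (b - a) < δ → |lambdaFn b - lambdaFn a| < ε := by
  rcases ha.2.eq_or_lt with h1 | h1
  · refine ⟨ε / 2, by positivity, fun b hb hab => ?_⟩
    have hd := hb.1.sub ha.1
    have hT : traceNorm a ≤ traceNorm b + traceNorm (b - a) := by
      rw [← traceNorm_sub_comm ha.1 hb.1]; exact traceNorm_le_add_sub hb.1 ha.1
    have hn : |‖b‖ - ‖a‖| ≤ traceNorm (b - a) :=
      (abs_norm_sub_norm_le b a).trans (norm_le_traceNorm hd)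
    have h2 := abs_le.1 hn
    have := norm_le_lambdaFn ha
    have := norm_le_lambdaFn hb
    have := lambdaFn_le ha
    have := lambdaFn_le hb
    rw [abs_lt]
    constructor <;> linarith
  · obtain ⟨r, hr, har⟩ : ∃ r : ℝ, 0 < r ∧ traceNorm a + 2 * r = 1 :=
      ⟨(1 - traceNorm a) / 2, by linarith, by ring⟩
    obtain ⟨θ, hθ, hθ1, hθε⟩ : ∃ θ : ℝ, 0 < θ ∧ θ ≤ 1 ∧ θ < ε :=
      ⟨min 1 (ε / 2), by positivity, min_le_left _ _, (min_le_right _ _).trans_lt (by linarith)⟩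
    refine ⟨θ * r, by positivity, fun b hb hab => ?_⟩
    have hdr : θ⁻¹ * traceNorm (b - a) ≤ r := by
      rw [inv_mul_le_iff₀ hθ]; exact hab.le
    have hbT := traceNorm_le_add_sub ha.1 hb.1
    have hd : traceNorm (b - a) ≤ r := by nlinarith
    have hle1 := lambdaFn_le_add ha hb.1 hθ hθ1 (by linarith)
    have hle2 := lambdaFn_le_add hb ha.1 hθ hθ1
      (by rw [traceNorm_sub_comm ha.1 hb.1]; linarith)
    rw [abs_lt]
    constructor <;> linarith
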